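/- Let R, μ, ν be probability distributions on the n×m pixel grid and let δ^μ be any flow with Δ(R, δ^μ) = μ. Then W₁(μ, ν) = min { ‖δ^μ − δ^ν‖₁ : δ^ν a flow with Δ(R, δ^ν) = ν }, and this minimum is attained. -/

import Mathlib

namespace WassersteinFlow

/-- A flow on the `n × m` grid: a pair `(δ→, δ↓)` with `δ→ ∈ ℝ^{n×(m-1)}`
and `δ↓ ∈ ℝ^{(n-1)×m}`. -/
abbrev Flow (n m : ℕ) := (Fin n → Fin (m - 1) → ℝ) × (Fin (n - 1) → Fin m → ℝ)

/-- Entry access with out-of-range indices giving `0` (0-based indices). -/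
def entry {a b : ℕ} (δ : Fin a → Fin b → ℝ) (i j : ℤ) : ℝ :=
  if h : 0 ≤ i ∧ i < (a : ℤ) ∧ 0 ≤ j ∧ j < (b : ℤ) then
    δ ⟨i.toNat, by omega⟩ ⟨j.toNat, by omega⟩
  else 0

/-- The flow application map `Δ`:
`Δ(μ,δ)_{i,j} = μ_{i,j} + δ↓_{i−1,j} + δ→_{i,j−1} − δ↓_{i,j} − δ→_{i,j}`,
with out-of-range entries taken to be `0`. -/
def applyFlow {n m : ℕ} (μ : Fin n × Fin m → ℝ) (δ : Flow n m) : Fin n × Fin m → ℝ :=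
  fun x =>
    μ x + entry δ.2 ((x.1 : ℤ) - 1) (x.2 : ℤ) + entry δ.1 (x.1 : ℤ) ((x.2 : ℤ) - 1)
      - entry δ.2 (x.1 : ℤ) (x.2 : ℤ) - entry δ.1 (x.1 : ℤ) (x.2 : ℤ)

/-- The `L¹`-norm of a flow: the sum of absolute values of all entries. -/
def flowL1 {n m : ℕ} (δ : Flow n m) : ℝ :=
  (∑ i, ∑ j, |δ.1 i j|) + (∑ i, ∑ j, |δ.2 i j|)

/-- A probability distribution on the grid. -/
def IsProbDist {n m : ℕ} (μ : Fin n × Fin m → ℝ) : Prop :=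
  (∀ x, 0 ≤ μ x) ∧ ∑ x, μ x = 1

/-- The `L¹` ground metric `d((i,j),(k,l)) = |i−k| + |j−l|` on the grid. -/
def gd {n m : ℕ} (x y : Fin n × Fin m) : ℝ :=
  ((|(x.1 : ℤ) - (y.1 : ℤ)| + |(x.2 : ℤ) - (y.2 : ℤ)| : ℤ) : ℝ)

/-- `π` is a coupling of `μ` and `ν`. -/
def IsCoupling {n m : ℕ} (μ ν : Fin n × Fin m → ℝ)
    (π : (Fin n × Fin m) × (Fin n × Fin m) → ℝ) : Prop :=
  (∀ p, 0 ≤ π p) ∧ (∀ x, ∑ y, π (x, y) = μ x) ∧ (∀ y, ∑ x, π (x, y) = ν y)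

/-- The 1-Wasserstein distance with `L¹` ground metric. -/
noncomputable def W1 {n m : ℕ} (μ ν : Fin n × Fin m → ℝ) : ℝ :=
  sInf {c | ∃ π, IsCoupling μ ν π ∧
    c = ∑ p : (Fin n × Fin m) × (Fin n × Fin m), gd p.1 p.2 * π p}

/-- Index type for flattened flows. -/
abbrev FlowIdx (n m : ℕ) := (Fin n × Fin (m - 1)) ⊕ (Fin (n - 1) × Fin m)

/-- Flatten a flow to a vector in `ℝ^{n(m−1)+(n−1)m}`. -/
def flat {n m : ℕ} (δ : Flow n m) : FlowIdx n m → ℝ :=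
  Sum.elim (fun p => δ.1 p.1 p.2) (fun p => δ.2 p.1 p.2)

section Transshipment

variable {X : Type*} [Fintype X]

/-- Among the transshipment plans with given net outflow and cost at most that of `π`, there is one
in which no point both receives and sends mass. -/
lemma exists_bipartite_transshipment (d : X → X → ℝ)
    (tri : ∀ x y z, d x z ≤ d x y + d y z) (σ : X → ℝ) (π : X × X → ℝ) (hπ : ∀ p, 0 ≤ π p)
    (hσ : ∀ x, ∑ y, π (x, y) - ∑ y, π (y, x) = σ x) :
    ∃ π' : X × X → ℝ, (∀ p, 0 ≤ π' p) ∧ (∀ x, ∑ y, π' (x, y) - ∑ y, π' (y, x) = σ x) ∧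
      ∑ p, d p.1 p.2 * π' p ≤ ∑ p, d p.1 p.2 * π p ∧
      ∀ x y z, π' (x, y) = 0 ∨ π' (y, z) = 0 := by
  classical
  set K : Set (X × X → ℝ) := {ρ | (∀ p, 0 ≤ ρ p) ∧
    (∀ x, ∑ y, ρ (x, y) - ∑ y, ρ (y, x) = σ x) ∧
    ∑ p, d p.1 p.2 * ρ p ≤ ∑ p, d p.1 p.2 * π p ∧ ∑ p, ρ p ≤ ∑ p, π p} with hK
  have hclosed : IsClosed K := by
    simp only [hK, Set.ofPred_and, Set.ofPred_forall]
    refine (isClosed_iInter fun p => ?_).inter ((isClosed_iInter fun x => ?_).inter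
      (IsClosed.inter ?_ ?_))
    · exact isClosed_le (by fun_prop) (by fun_prop)
    · exact isClosed_eq (by fun_prop) (by fun_prop)
    · exact isClosed_le (by fun_prop) (by fun_prop)
    · exact isClosed_le (by fun_prop) (by fun_prop)
  have hcompact : IsCompact K := by
    refine (isCompact_Icc (a := (0 : X × X → ℝ)) (b := fun _ => ∑ p, π p)).of_isClosed_subset
      hclosed ?_
    rintro ρ ⟨h0, -, -, h1⟩
    exact ⟨h0, fun p => (Finset.single_le_sum (fun q _ => h0 q) (Finset.mem_univ p)).trans h1⟩
  obtain ⟨ρ, ⟨h0, h1, h2, h3⟩, hmin⟩ := hcompact.exists_isMinOn (f := fun ρ => ∑ p, ρ p)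
    ⟨π, hπ, hσ, le_rfl, le_rfl⟩ (by fun_prop)
  refine ⟨ρ, h0, h1, h2, fun x y z => ?_⟩
  by_contra! hne
  have hxy : 0 < ρ (x, y) := (h0 _).lt_of_ne' hne.1
  have hyz : 0 < ρ (y, z) := (h0 _).lt_of_ne' hne.2
  set ε := min (ρ (x, y)) (ρ (y, z)) with hε
  have hεpos : 0 < ε := lt_min hxy hyz
  have hεx : ε ≤ ρ (x, y) := min_le_left _ _
  have hεz : ε ≤ ρ (y, z) := min_le_right _ _
  set ρ' : X × X → ℝ := fun p => ρ p + (if p = (x, z) then ε else 0)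
    - (if p = (x, y) then ε else 0) - (if p = (y, z) then ε else 0) with hρ'
  have hsum : ∑ p, ρ' p = ∑ p, ρ p - ε := by
    simp [hρ', Finset.sum_sub_distrib, Finset.sum_add_distrib]
  have hcost : ∑ p, d p.1 p.2 * ρ' p
      = ∑ p, d p.1 p.2 * ρ p + d x z * ε - d x y * ε - d y z * ε := by
    simp [hρ', mul_sub, mul_add, Finset.sum_sub_distrib, Finset.sum_add_distrib]
  have hmem : ρ' ∈ K := by
    refine ⟨fun p => ?_, fun w => ?_, ?_, ?_⟩
    · have hp := h0 p
      simp only [hρ']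
      by_cases hp1 : p = (x, y)
      · subst hp1
        by_cases hp2 : (x, y) = (y, z)
        · obtain ⟨rfl, rfl⟩ := Prod.mk.inj hp2
          simp; linarith
        · simp only [hp2, if_true, if_false]
          split_ifs <;> linarith
      · by_cases hp2 : p = (y, z)
        · subst hp2
          simp only [hp1, if_true, if_false]
          split_ifs <;> linarith
        · simp only [hp1, hp2, if_false]
          split_ifs <;> linarith
    · rw [← h1 w]
      simp only [hρ', Finset.sum_sub_distrib, Finset.sum_add_distrib, Prod.mk.injEq, ite_and,
        Finset.sum_ite_eq', Finset.mem_univ, if_true, Finset.sum_ite_irrel, Finset.sum_const_zero]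
      ring
    · rw [hcost]
      nlinarith [mul_le_mul_of_nonneg_right (tri x y z) hεpos.le]
    · linarith
  have hle : ∑ p, ρ p ≤ ∑ p, ρ' p := hmin hmem
  linarith

/-- A transshipment plan from `μ` to `ν` can be replaced by a coupling of no larger cost. -/
lemma exists_coupling_of_transshipment (d : X → X → ℝ) (hd : ∀ x, d x x = 0)
    (tri : ∀ x y z, d x z ≤ d x y + d y z) (μ ν : X → ℝ) (hμ : ∀ x, 0 ≤ μ x) (hν : ∀ x, 0 ≤ ν x)
    (π : X × X → ℝ) (hπ : ∀ p, 0 ≤ π p)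
    (hdiv : ∀ x, ∑ y, π (x, y) - ∑ y, π (y, x) = μ x - ν x) :
    ∃ π' : X × X → ℝ, (∀ p, 0 ≤ π' p) ∧ (∀ x, ∑ y, π' (x, y) = μ x) ∧
      (∀ y, ∑ x, π' (x, y) = ν y) ∧ ∑ p, d p.1 p.2 * π' p ≤ ∑ p, d p.1 p.2 * π p := by
  classical
  obtain ⟨ρ, h0, h1, h2, h3⟩ := exists_bipartite_transshipment d tri _ π hπ hdiv
  have hout : ∀ x, ∑ y, ρ (x, y) ≤ μ x := by
    intro x
    by_cases h : ∀ y, ρ (x, y) = 0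
    · simpa [h] using hμ x
    · push Not at h
      obtain ⟨z, hz⟩ := h
      have hin : ∀ y, ρ (y, x) = 0 := fun y => (h3 y x z).resolve_right hz
      have := h1 x
      simp only [hin, Finset.sum_const_zero] at this
      linarith [hν x]
  refine ⟨fun p => ρ p + if p.1 = p.2 then μ p.1 - ∑ y, ρ (p.1, y) else 0,
    fun p => ?_, fun x => ?_, fun y => ?_, ?_⟩
  · have := hout p.1
    have := h0 p
    dsimp only
    split_ifs <;> linarith
  · simp [Finset.sum_add_distrib]
  · have := h1 y
    simp only [Finset.sum_add_distrib, Finset.sum_ite_eq', Finset.mem_univ, if_true]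
    linarith
  · refine le_of_eq_of_le (Finset.sum_congr rfl fun p _ => ?_) h2
    dsimp only
    split_ifs with h
    · rw [h, hd]; simp
    · simp

end Transshipment

section Flow

variable {n m : ℕ}

lemma entry_add {a b : ℕ} (δ δ' : Fin a → Fin b → ℝ) (i j : ℤ) :
    entry (δ + δ') i j = entry δ i j + entry δ' i j := by
  unfold entry; split_ifs <;> simp

lemma entry_smul {a b : ℕ} (c : ℝ) (δ : Fin a → Fin b → ℝ) (i j : ℤ) :
    entry (c • δ) i j = c * entry δ i j := by
  unfold entry; split_ifs <;> simp

lemma entry_eq_sum {a b : ℕ} (δ : Fin a → Fin b → ℝ) (k l : ℤ) :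
    entry δ k l = ∑ i : Fin a, ∑ j : Fin b, δ i j * if (i : ℤ) = k ∧ (j : ℤ) = l then 1 else 0 := by
  unfold entry
  split_ifs with h
  · rw [Finset.sum_eq_single ⟨k.toNat, by omega⟩, Finset.sum_eq_single ⟨l.toNat, by omega⟩]
    · rw [if_pos (by constructor <;> simp <;> omega), mul_one]
    · intro j _ hj
      rw [if_neg, mul_zero]
      rintro ⟨-, rfl⟩
      exact hj (by simp)
    · simp
    · intro i _ hi
      refine Finset.sum_eq_zero fun j _ => ?_
      rw [if_neg, mul_zero]
      rintro ⟨rfl, -⟩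
      exact hi (by simp)
    · simp
  · refine (Finset.sum_eq_zero fun i _ => Finset.sum_eq_zero fun j _ => ?_).symm
    rw [if_neg, mul_zero]
    rintro ⟨rfl, rfl⟩
    exact h (by omega)

/-- The net inflow of a flow at every pixel. -/
noncomputable def netInflow : Flow n m →ₗ[ℝ] (Fin n × Fin m → ℝ) where
  toFun δ := applyFlow 0 δ
  map_add' δ δ' := by
    ext x; simp only [applyFlow, Prod.fst_add, Prod.snd_add, entry_add, Pi.add_apply, Pi.zero_apply]
    ring
  map_smul' c δ := by
    ext x
    simp only [applyFlow, Prod.smul_fst, Prod.smul_snd, entry_smul, Pi.smul_apply, Pi.zero_apply,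
      RingHom.id_apply, smul_eq_mul]
    ring

lemma applyFlow_eq (μ : Fin n × Fin m → ℝ) (δ : Flow n m) :
    applyFlow μ δ = μ + netInflow δ := by
  ext x
  simp only [netInflow, LinearMap.coe_mk, AddHom.coe_mk, applyFlow, Pi.add_apply, Pi.zero_apply]
  ring

/-- The left pixel of a horizontal edge. -/
def leftEnd (i : Fin n) (j : Fin (m - 1)) : Fin n × Fin m := (i, ⟨j, by omega⟩)

/-- The right pixel of a horizontal edge. -/
def rightEnd (i : Fin n) (j : Fin (m - 1)) : Fin n × Fin m := (i, ⟨j + 1, by omega⟩)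

/-- The upper pixel of a vertical edge. -/
def upperEnd (i : Fin (n - 1)) (j : Fin m) : Fin n × Fin m := (⟨i, by omega⟩, j)

/-- The lower pixel of a vertical edge. -/
def lowerEnd (i : Fin (n - 1)) (j : Fin m) : Fin n × Fin m := (⟨i + 1, by omega⟩, j)

lemma netInflow_eq_sum (δ : Flow n m) :
    netInflow δ = (∑ i, ∑ j, δ.1 i j • (Pi.single (rightEnd i j) 1 - Pi.single (leftEnd i j) 1)) +
      ∑ i, ∑ j, δ.2 i j • (Pi.single (lowerEnd i j) 1 - Pi.single (upperEnd i j) 1) := by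
  ext ⟨k, l⟩
  simp only [netInflow, LinearMap.coe_mk, AddHom.coe_mk, applyFlow, Pi.zero_apply, entry_eq_sum,
    Pi.add_apply, Finset.sum_apply, Pi.smul_apply, Pi.sub_apply, smul_eq_mul, mul_sub,
    Finset.sum_sub_distrib, Pi.single_apply, rightEnd, leftEnd, lowerEnd, upperEnd, Prod.mk.injEq,
    Fin.ext_iff]
  have e1 : ∀ (a b : ℕ), ((a : ℤ) = (b : ℤ) - 1) ↔ b = a + 1 := by intros; omega
  have e2 : ∀ (a b : ℕ), ((a : ℤ) = (b : ℤ)) ↔ b = a := by intros; omega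
  simp only [e1, e2]
  ring

lemma flowL1_zero : flowL1 (0 : Flow n m) = 0 := by simp [flowL1]

lemma flowL1_add_le (δ δ' : Flow n m) : flowL1 (δ + δ') ≤ flowL1 δ + flowL1 δ' := by
  unfold flowL1
  rw [add_add_add_comm]
  simp only [← Finset.sum_add_distrib]
  gcongr <;> exact abs_add_le _ _

lemma flowL1_smul (c : ℝ) (δ : Flow n m) : flowL1 (c • δ) = |c| * flowL1 δ := by
  simp [flowL1, abs_mul, mul_add, Finset.mul_sum]

lemma flowL1_neg (δ : Flow n m) : flowL1 (-δ) = flowL1 δ := by simp [flowL1]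

lemma flowL1_sum_le {ι : Type*} (s : Finset ι) (δ : ι → Flow n m) :
    flowL1 (∑ i ∈ s, δ i) ≤ ∑ i ∈ s, flowL1 (δ i) :=
  Finset.le_sum_of_subadditive _ flowL1_zero.le flowL1_add_le s δ

lemma exists_flow_right (i : Fin n) (j : Fin (m - 1)) : ∃ δ : Flow n m,
    netInflow δ = Pi.single (rightEnd i j) 1 - Pi.single (leftEnd i j) 1 ∧ flowL1 δ = 1 := by
  refine ⟨(fun a b => if a = i then if b = j then 1 else 0 else 0, 0), ?_, ?_⟩
  · simp [netInflow_eq_sum, ite_smul]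
  · simp [flowL1, apply_ite abs]

lemma exists_flow_down (i : Fin (n - 1)) (j : Fin m) : ∃ δ : Flow n m,
    netInflow δ = Pi.single (lowerEnd i j) 1 - Pi.single (upperEnd i j) 1 ∧ flowL1 δ = 1 := by
  refine ⟨(0, fun a b => if a = i then if b = j then 1 else 0 else 0), ?_, ?_⟩
  · simp [netInflow_eq_sum, ite_smul]
  · simp [flowL1, apply_ite abs]

/-- Unit mass can be moved from `x` to `y` at cost at most `c`. -/
def FlowReach (x y : Fin n × Fin m) (c : ℝ) : Prop :=
  ∃ δ : Flow n m, netInflow δ = Pi.single y 1 - Pi.single x 1 ∧ flowL1 δ ≤ c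

lemma FlowReach.refl (x : Fin n × Fin m) : FlowReach x x 0 := ⟨0, by simp, flowL1_zero.le⟩

lemma FlowReach.symm {x y : Fin n × Fin m} {c : ℝ} (h : FlowReach x y c) : FlowReach y x c := by
  obtain ⟨δ, h1, h2⟩ := h
  exact ⟨-δ, by simp [h1], by rwa [flowL1_neg]⟩

lemma FlowReach.trans {x y z : Fin n × Fin m} {c d : ℝ} (h : FlowReach x y c)
    (h' : FlowReach y z d) : FlowReach x z (c + d) := by
  obtain ⟨δ, h1, h2⟩ := h
  obtain ⟨δ', h1', h2'⟩ := h'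
  exact ⟨δ + δ', by simp [h1, h1'], (flowL1_add_le _ _).trans (add_le_add h2 h2')⟩

lemma flowReach_row_add (i : Fin n) (j k : ℕ) (h : j + k < m) :
    FlowReach (i, ⟨j, by omega⟩) (i, ⟨j + k, h⟩) k := by
  induction k with
  | zero => simpa using FlowReach.refl _
  | succ k ih =>
    obtain ⟨δ, h1, h2⟩ := exists_flow_right i (⟨j + k, by omega⟩ : Fin (m - 1))
    push_cast
    exact (ih (by omega)).trans ⟨δ, h1, h2.le⟩

lemma flowReach_col_add (j : Fin m) (i k : ℕ) (h : i + k < n) :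
    FlowReach (⟨i, by omega⟩, j) (⟨i + k, h⟩, j) k := by
  induction k with
  | zero => simpa using FlowReach.refl _
  | succ k ih =>
    obtain ⟨δ, h1, h2⟩ := exists_flow_down (⟨i + k, by omega⟩ : Fin (n - 1)) j
    push_cast
    exact (ih (by omega)).trans ⟨δ, h1, h2.le⟩

lemma flowReach_row (i : Fin n) (j l : Fin m) :
    FlowReach (i, j) (i, l) (|(j : ℤ) - (l : ℤ)| : ℤ) := by
  wlog hjl : j ≤ l generalizing j l
  · rw [abs_sub_comm]; exact (this l j (le_of_not_ge hjl)).symm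
  obtain ⟨k, hk⟩ := Nat.exists_eq_add_of_le (Fin.le_def.mp hjl)
  obtain ⟨l, hl⟩ := l
  obtain rfl : l = j + k := hk
  simpa using flowReach_row_add i j k hl

lemma flowReach_col (j : Fin m) (i l : Fin n) :
    FlowReach (i, j) (l, j) (|(i : ℤ) - (l : ℤ)| : ℤ) := by
  wlog hil : i ≤ l generalizing i l
  · rw [abs_sub_comm]; exact (this l i (le_of_not_ge hil)).symm
  obtain ⟨k, hk⟩ := Nat.exists_eq_add_of_le (Fin.le_def.mp hil)
  obtain ⟨l, hl⟩ := l
  obtain rfl : l = i + k := hk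
  simpa using flowReach_col_add j i k hl

lemma flowReach_gd (x y : Fin n × Fin m) : FlowReach x y (gd x y) := by
  unfold gd
  rw [Int.cast_add]
  exact (flowReach_col x.2 x.1 y.1).trans (flowReach_row y.1 x.2 y.2)

/-- Routing a coupling along grid paths gives a flow of no larger norm. -/
lemma exists_flow_of_coupling {μ ν : Fin n × Fin m → ℝ}
    {π : (Fin n × Fin m) × (Fin n × Fin m) → ℝ} (hπ : IsCoupling μ ν π) :
    ∃ δ : Flow n m, netInflow δ = ν - μ ∧ flowL1 δ ≤ ∑ p, gd p.1 p.2 * π p := by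
  obtain ⟨h0, h1, h2⟩ := hπ
  choose f hf hf' using fun p : (Fin n × Fin m) × (Fin n × Fin m) => flowReach_gd p.1 p.2
  refine ⟨∑ p, π p • f p, ?_, (flowL1_sum_le _ _).trans (Finset.sum_le_sum fun p _ => ?_)⟩
  · ext x
    simp only [map_sum, map_smul, hf, Finset.sum_apply, Pi.smul_apply, Pi.sub_apply, smul_eq_mul,
      mul_sub, Finset.sum_sub_distrib, ← h1 x, ← h2 x, Pi.single_apply, mul_ite, mul_one, mul_zero]
    congr 1
    · rw [Fintype.sum_prod_type]; simp
    · rw [Fintype.sum_prod_type_right]; simp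
  · rw [flowL1_smul, abs_of_nonneg (h0 p), mul_comm]
    exact mul_le_mul_of_nonneg_right (hf' p) (h0 p)

/-- The net inflow `σ` is realized by a transshipment plan of cost at most `c`. -/
def PlanReach (σ : Fin n × Fin m → ℝ) (c : ℝ) : Prop :=
  ∃ π : (Fin n × Fin m) × (Fin n × Fin m) → ℝ, (∀ p, 0 ≤ π p) ∧
    (∀ x, ∑ y, π (y, x) - ∑ y, π (x, y) = σ x) ∧ ∑ p, gd p.1 p.2 * π p ≤ c

lemma PlanReach.zero : PlanReach (0 : Fin n × Fin m → ℝ) 0 := ⟨0, by simp, by simp, by simp⟩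

lemma PlanReach.add {σ τ : Fin n × Fin m → ℝ} {c d : ℝ} (h : PlanReach σ c) (h' : PlanReach τ d) :
    PlanReach (σ + τ) (c + d) := by
  obtain ⟨π, h1, h2, h3⟩ := h
  obtain ⟨ρ, h1', h2', h3'⟩ := h'
  refine ⟨π + ρ, fun p => add_nonneg (h1 p) (h1' p), fun x => ?_, ?_⟩
  · simp only [Pi.add_apply, Finset.sum_add_distrib, ← h2 x, ← h2' x]; ring
  · simp only [Pi.add_apply, mul_add, Finset.sum_add_distrib]; linarith

lemma PlanReach.sum {ι : Type*} (s : Finset ι) {σ : ι → Fin n × Fin m → ℝ} {c : ι → ℝ}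
    (h : ∀ i, PlanReach (σ i) (c i)) : PlanReach (∑ i ∈ s, σ i) (∑ i ∈ s, c i) := by
  classical
  induction s using Finset.induction_on with
  | empty => simpa using PlanReach.zero
  | insert i s hi ih => simpa only [Finset.sum_insert hi] using (h i).add ih

lemma planReach_pair_of_nonneg {a : ℝ} (ha : 0 ≤ a) (x y : Fin n × Fin m) :
    PlanReach (a • (Pi.single y 1 - Pi.single x 1)) (a * gd x y) := by
  refine ⟨fun p => if p = (x, y) then a else 0, fun p => ?_, fun w => ?_, ?_⟩
  · dsimp only; split_ifs <;> simp [ha]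
  · simp only [Prod.mk.injEq, ite_and, Finset.sum_ite_eq', Finset.mem_univ, if_true,
      Finset.sum_ite_irrel, Finset.sum_const_zero, Pi.smul_apply, Pi.sub_apply, Pi.single_apply,
      smul_eq_mul, mul_sub, mul_ite, mul_one, mul_zero]
  · simp [mul_comm]

lemma gd_comm (x y : Fin n × Fin m) : gd x y = gd y x := by
  unfold gd
  rw [abs_sub_comm (x.1 : ℤ), abs_sub_comm (x.2 : ℤ)]

lemma gd_self (x : Fin n × Fin m) : gd x x = 0 := by simp [gd]

lemma gd_triangle (x y z : Fin n × Fin m) : gd x z ≤ gd x y + gd y z := by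
  unfold gd
  rw [← Int.cast_add, Int.cast_le]
  have h1 := abs_sub_le (x.1 : ℤ) y.1 z.1
  have h2 := abs_sub_le (x.2 : ℤ) y.2 z.2
  linarith

lemma planReach_pair (a : ℝ) {x y : Fin n × Fin m} (h : gd x y = 1) :
    PlanReach (a • (Pi.single y 1 - Pi.single x 1)) |a| := by
  rcases le_total 0 a with ha | ha
  · simpa [h, abs_of_nonneg ha] using planReach_pair_of_nonneg ha x y
  · simpa [gd_comm y x, h, abs_of_nonpos ha, smul_sub, sub_eq_add_neg, add_comm] using
      planReach_pair_of_nonneg (neg_nonneg.mpr ha) y x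

lemma planReach_netInflow (δ : Flow n m) : PlanReach (netInflow δ) (flowL1 δ) := by
  rw [netInflow_eq_sum, flowL1]
  refine .add (.sum _ fun i => .sum _ fun j => planReach_pair _ ?_)
    (.sum _ fun i => .sum _ fun j => planReach_pair _ ?_)
  · simp [gd, leftEnd, rightEnd]
  · simp [gd, upperEnd, lowerEnd]

/-- A flow from `μ` to `ν` yields a coupling whose cost is at most the norm of the flow. -/
lemma exists_coupling_of_flow {μ ν : Fin n × Fin m → ℝ} (hμ : ∀ x, 0 ≤ μ x) (hν : ∀ x, 0 ≤ ν x)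
    {δ : Flow n m} (hδ : netInflow δ = ν - μ) :
    ∃ π, IsCoupling μ ν π ∧ ∑ p, gd p.1 p.2 * π p ≤ flowL1 δ := by
  obtain ⟨π, h1, h2, h3⟩ := planReach_netInflow δ
  obtain ⟨ρ, r0, r1, r2, r3⟩ := exists_coupling_of_transshipment gd gd_self gd_triangle μ ν hμ hν
    π h1 (fun x => by have := h2 x; rw [hδ, Pi.sub_apply] at this; linarith)
  exact ⟨ρ, ⟨r0, r1, r2⟩, r3.trans h3⟩

lemma isCompact_setOf_isCoupling (μ ν : Fin n × Fin m → ℝ) : IsCompact {π | IsCoupling μ ν π} := by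
  refine (isCompact_Icc (a := (0 : (Fin n × Fin m) × (Fin n × Fin m) → ℝ))
    (b := fun p => μ p.1)).of_isClosed_subset ?_ ?_
  · simp only [IsCoupling, Set.ofPred_and, Set.ofPred_forall]
    refine (isClosed_iInter fun p => ?_).inter ((isClosed_iInter fun x => ?_).inter
      (isClosed_iInter fun x => ?_))
    · exact isClosed_le (by fun_prop) (by fun_prop)
    · exact isClosed_eq (by fun_prop) (by fun_prop)
    · exact isClosed_eq (by fun_prop) (by fun_prop)
  · rintro π ⟨h0, h1, -⟩
    refine ⟨h0, fun p => ?_⟩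
    dsimp only
    rw [← h1 p.1]
    exact Finset.single_le_sum (f := fun y => π (p.1, y)) (fun y _ => h0 _) (Finset.mem_univ p.2)

/-- The infimum defining `W1` is attained. -/
lemma exists_isLeast_W1 {μ ν : Fin n × Fin m → ℝ} (hμ : IsProbDist μ) (hν : IsProbDist ν) :
    ∃ π, IsCoupling μ ν π ∧ ∑ p, gd p.1 p.2 * π p = W1 μ ν ∧
      ∀ ρ, IsCoupling μ ν ρ → W1 μ ν ≤ ∑ p, gd p.1 p.2 * ρ p := by
  have hne : {π | IsCoupling μ ν π}.Nonempty := by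
    refine ⟨fun p => μ p.1 * ν p.2, fun p => mul_nonneg (hμ.1 _) (hν.1 _), fun x => ?_,
      fun y => ?_⟩
    · simp [← Finset.mul_sum, hν.2]
    · simp [← Finset.sum_mul, hμ.2]
  obtain ⟨π, hπ, hmin⟩ := (isCompact_setOf_isCoupling μ ν).exists_isMinOn
    (f := fun π => ∑ p, gd p.1 p.2 * π p) hne (by fun_prop)
  have hW : W1 μ ν = ∑ p, gd p.1 p.2 * π p :=
    IsLeast.csInf_eq ⟨⟨π, hπ, rfl⟩, by rintro c ⟨ρ, hρ, rfl⟩; exact hmin hρ⟩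
  exact ⟨π, hπ, hW.symm, fun ρ hρ => hW.trans_le (hmin hρ)⟩

end Flow

/-- For a fixed reference `R` and a flow `δ^μ` with `Δ(R, δ^μ) = μ`,
`W₁(μ, ν) = min { ‖δ^μ − δ^ν‖₁ : Δ(R, δ^ν) = ν }`, the minimum being attained. -/
theorem W1_eq_min_flowL1_sub (n m : ℕ) (R μ ν : Fin n × Fin m → ℝ)
    (hR : IsProbDist R) (hμ : IsProbDist μ) (hν : IsProbDist ν)
    (δμ : Flow n m) (hδμ : applyFlow R δμ = μ) :
    ∃ δν : Flow n m, applyFlow R δν = ν ∧ flowL1 (δμ - δν) = W1 μ ν ∧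
      ∀ δ' : Flow n m, applyFlow R δ' = ν → flowL1 (δμ - δν) ≤ flowL1 (δμ - δ') := by
  obtain ⟨π, hπ, hcost, hleast⟩ := exists_isLeast_W1 hμ hν
  obtain ⟨δ, hδ, hle⟩ := exists_flow_of_coupling hπ
  have lower : ∀ δ' : Flow n m, applyFlow R δ' = ν → W1 μ ν ≤ flowL1 (δμ - δ') := by
    intro δ' hδ'
    have hdiff : netInflow (δ' - δμ) = ν - μ := by
      rw [← hδ', ← hδμ, applyFlow_eq, applyFlow_eq, map_sub]; abel
    obtain ⟨ρ, hρ, hρc⟩ := exists_coupling_of_flow hμ.1 hν.1 hdiff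
    rw [← flowL1_neg, neg_sub]
    exact (hleast ρ hρ).trans hρc
  have happ : applyFlow R (δμ + δ) = ν := by
    rw [applyFlow_eq, map_add, hδ, ← add_assoc, ← applyFlow_eq, hδμ]; abel
  have heq : flowL1 (δμ - (δμ + δ)) = W1 μ ν := by
    refine le_antisymm ?_ (lower _ happ)
    rw [sub_add_cancel_left, flowL1_neg, ← hcost]
    exact hle
  exact ⟨δμ + δ, happ, heq, fun δ' hδ' => heq.trans_le (lower δ' hδ')⟩

end WassersteinFlow
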